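/- arXiv:1211.5657 — 2 statements merged into one kernel-verified Lean document; each statement's English description precedes it below -/
import Mathlib

section
/- Let β > 1. Assume the core energies Q_GL and Q_{[1,0]}(β) exist. Then Q_GL < 2·Q_{[1,0]}(β); moreover, if the limit defining Q_{[1,1]}(β) also exists, then Q_{[1,1]}(β) = Q_GL. -/
open MeasureTheory Metric Set Filter Complex

noncomputable section

/-- Sum of squared norms of the two first-order partial derivatives (plane identified with `ℂ`). -/
def gradSq (f : ℂ → ℂ) (x : ℂ) : ℝ :=
  ‖fderiv ℝ f x 1‖ ^ 2 + ‖fderiv ℝ f x Complex.I‖ ^ 2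

/-- Two-component Ginzburg–Landau energy density on the unit disk. -/
def eDen (ε β : ℝ) (ψp ψm : ℂ → ℂ) (x : ℂ) : ℝ :=
  (1 / 2) * (gradSq ψp x + gradSq ψm x)
    + (1 / (4 * ε ^ 2)) * ((‖ψp x‖ ^ 2 + ‖ψm x‖ ^ 2 - 1) ^ 2)
    + (β / (4 * ε ^ 2)) * ((‖ψp x‖ ^ 2 - ‖ψm x‖ ^ 2) ^ 2)

/-- Two-component Ginzburg–Landau energy on the unit disk. -/
def En (ε β : ℝ) (ψp ψm : ℂ → ℂ) : ℝ := ∫ x in ball (0 : ℂ) 1, eDen ε β ψp ψm x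

/-- Scalar Ginzburg–Landau energy density. -/
def gDen (ε : ℝ) (u : ℂ → ℂ) (x : ℂ) : ℝ :=
  (1 / 2) * gradSq u x + (1 / (4 * ε ^ 2)) * ((1 - ‖u x‖ ^ 2) ^ 2)

/-- Scalar Ginzburg–Landau energy on the unit disk. -/
def Gn (ε : ℝ) (u : ℂ → ℂ) : ℝ := ∫ x in ball (0 : ℂ) 1, gDen ε u x

/-- Admissible two-component map with boundary degrees `(np, nm)`. -/
def AdmissiblePair (ε β : ℝ) (np nm : ℕ) (ψp ψm : ℂ → ℂ) : Prop :=
  ContinuousOn ψp (closedBall 0 1) ∧ ContinuousOn ψm (closedBall 0 1) ∧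
  ContDiffOn ℝ 1 ψp (ball 0 1) ∧ ContDiffOn ℝ 1 ψm (ball 0 1) ∧
  IntegrableOn (eDen ε β ψp ψm) (ball 0 1) ∧
  ∀ x : ℂ, ‖x‖ = 1 →
    ψp x = (Real.sqrt 2 : ℂ)⁻¹ * x ^ np ∧ ψm x = (Real.sqrt 2 : ℂ)⁻¹ * x ^ nm

/-- The infimum `I_{[np,nm]}(ε;β)`. -/
def Ival (ε β : ℝ) (np nm : ℕ) : ℝ :=
  sInf { e : ℝ | ∃ ψp ψm : ℂ → ℂ, AdmissiblePair ε β np nm ψp ψm ∧ e = En ε β ψp ψm }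

/-- Admissible scalar map with degree-one boundary condition. -/
def AdmissibleScalar (ε : ℝ) (u : ℂ → ℂ) : Prop :=
  ContinuousOn u (closedBall 0 1) ∧ ContDiffOn ℝ 1 u (ball 0 1) ∧
  IntegrableOn (gDen ε u) (ball 0 1) ∧ ∀ x : ℂ, ‖x‖ = 1 → u x = x

/-- The infimum `I_GL(ε)`. -/
def IGL (ε : ℝ) : ℝ :=
  sInf { e : ℝ | ∃ u : ℂ → ℂ, AdmissibleScalar ε u ∧ e = Gn ε u }

/-- Spin of a two-component map. -/
def spin (ψp ψm : ℂ → ℂ) (x : ℂ) : ℝ := (1 / 2) * (‖ψm x‖ ^ 2 - ‖ψp x‖ ^ 2)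

lemma gradSq_nonneg (f : ℂ → ℂ) (x : ℂ) : 0 ≤ gradSq f x := by
  unfold gradSq; positivity

lemma gradSq_const_mul (c : ℂ) (f : ℂ → ℂ) (x : ℂ) :
    gradSq (fun y => c * f y) x = ‖c‖ ^ 2 * gradSq f x := by
  have h : fderiv ℝ (fun y => c * f y) x = c • fderiv ℝ f x :=
    congrFun (fderiv_const_smul_field (𝕜 := ℝ) (f := f) c) x
  simp only [gradSq, h, smul_apply, norm_smul, mul_pow]
  ring

lemma continuousOn_gradSq {f : ℂ → ℂ} (hf : ContDiffOn ℝ 1 f (ball 0 1)) :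
    ContinuousOn (gradSq f) (ball 0 1) := by
  have h := hf.continuousOn_fderiv_of_isOpen isOpen_ball le_rfl
  unfold gradSq
  exact ((h.clm_apply continuousOn_const).norm.pow 2).add
    ((h.clm_apply continuousOn_const).norm.pow 2)

lemma continuousOn_gDen {f : ℂ → ℂ} (ε : ℝ) (hf : ContDiffOn ℝ 1 f (ball 0 1)) :
    ContinuousOn (gDen ε f) (ball 0 1) := by
  unfold gDen
  exact (continuousOn_const.mul (continuousOn_gradSq hf)).add
    (continuousOn_const.mul ((continuousOn_const.sub (hf.continuousOn.norm.pow 2)).pow 2))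

lemma gDen_nonneg (ε : ℝ) (u : ℂ → ℂ) (x : ℂ) : 0 ≤ gDen ε u x := by
  have := gradSq_nonneg u x
  unfold gDen; positivity

lemma eDen_nonneg {β : ℝ} (hβ : 0 ≤ β) (ε : ℝ) (ψp ψm : ℂ → ℂ) (x : ℂ) :
    0 ≤ eDen ε β ψp ψm x := by
  have := gradSq_nonneg ψp x
  have := gradSq_nonneg ψm x
  unfold eDen; positivity

lemma bddBelow_scalarEnergies (ε : ℝ) :
    BddBelow {e : ℝ | ∃ u : ℂ → ℂ, AdmissibleScalar ε u ∧ e = Gn ε u} := by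
  refine ⟨0, ?_⟩
  rintro e ⟨u, -, rfl⟩
  exact integral_nonneg fun x => gDen_nonneg ε u x

lemma bddBelow_pairEnergies {β : ℝ} (hβ : 0 ≤ β) (ε : ℝ) (np nm : ℕ) :
    BddBelow {e : ℝ | ∃ ψp ψm : ℂ → ℂ,
      AdmissiblePair ε β np nm ψp ψm ∧ e = En ε β ψp ψm} := by
  refine ⟨0, ?_⟩
  rintro e ⟨ψp, ψm, -, rfl⟩
  exact integral_nonneg fun x => eDen_nonneg hβ ε ψp ψm x

lemma norm_sqrt_two_sq : ‖(Real.sqrt 2 : ℂ)‖ ^ 2 = 2 := by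
  rw [Complex.norm_real, Real.norm_eq_abs, sq_abs, Real.sq_sqrt zero_le_two]

lemma sqrt_two_ne_zero : (Real.sqrt 2 : ℂ) ≠ 0 := by
  exact_mod_cast (Real.sqrt_pos.2 zero_lt_two).ne'

/-- On a diagonal pair the two-component density is the scalar one. -/
lemma eDen_diagonal (ε β : ℝ) (u : ℂ → ℂ) (x : ℂ) :
    eDen ε β (fun y => (Real.sqrt 2 : ℂ)⁻¹ * u y) (fun y => (Real.sqrt 2 : ℂ)⁻¹ * u y) x = gDen ε u x := by
  simp only [eDen, gDen, gradSq_const_mul, norm_mul, norm_inv, mul_pow, inv_pow,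
    norm_sqrt_two_sq]
  ring

/-- Minimising the potential in the second component leaves the scalar potential with the
effective length `δ`, where `δ⁻² = (2β / (1 + β)) ε⁻²`. -/
lemma gDen_le_two_mul_eDen {ε β δ : ℝ} (hβ : 0 < β)
    (hδ : 1 / δ ^ 2 = 2 * β / (1 + β) * (1 / ε ^ 2)) (ψp ψm : ℂ → ℂ) (x : ℂ) :
    gDen δ (fun y => (Real.sqrt 2 : ℂ) * ψp y) x ≤ 2 * eDen ε β ψp ψm x := by
  simp only [eDen, gDen, gradSq_const_mul, norm_mul, mul_pow, norm_sqrt_two_sq]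
  have hm := gradSq_nonneg ψm x
  generalize ‖ψp x‖ ^ 2 = a
  generalize ‖ψm x‖ ^ 2 = b
  have key : β / (1 + β) * (1 - 2 * a) ^ 2 ≤ (a + b - 1) ^ 2 + β * (a - b) ^ 2 := by
    rw [div_mul_eq_mul_div, div_le_iff₀ (by linarith)]
    nlinarith [sq_nonneg ((a + b - 1) - β * (a - b))]
  have hε : 0 ≤ 1 / ε ^ 2 := by positivity
  have h := mul_le_mul_of_nonneg_left key hε
  have e₁ : 1 / (4 * δ ^ 2) = 1 / 4 * (2 * β / (1 + β) * (1 / ε ^ 2)) := by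
    rw [← hδ]; ring
  rw [e₁]
  have e₂ : 1 / (4 * ε ^ 2) = 1 / 4 * (1 / ε ^ 2) := by ring
  have e₃ : β / (4 * ε ^ 2) = β / 4 * (1 / ε ^ 2) := by ring
  have e₄ : 2 * β / (1 + β) = 2 * (β / (1 + β)) := by ring
  rw [e₂, e₃, e₄]
  nlinarith

lemma gDen_add_gDen_le_two_mul_eDen {β : ℝ} (hβ : 1 ≤ β) (ε : ℝ) (ψp ψm : ℂ → ℂ) (x : ℂ) :
    gDen ε (fun y => (Real.sqrt 2 : ℂ) * ψp y) x + gDen ε (fun y => (Real.sqrt 2 : ℂ) * ψm y) x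
      ≤ 2 * eDen ε β ψp ψm x := by
  simp only [eDen, gDen, gradSq_const_mul, norm_mul, mul_pow, norm_sqrt_two_sq]
  have hε : 0 ≤ 1 / ε ^ 2 := by positivity
  have h := mul_nonneg (mul_nonneg hε (sub_nonneg.2 hβ))
    (sq_nonneg (‖ψp x‖ ^ 2 - ‖ψm x‖ ^ 2))
  have e₂ : 1 / (4 * ε ^ 2) = 1 / 4 * (1 / ε ^ 2) := by ring
  have e₃ : β / (4 * ε ^ 2) = β / 4 * (1 / ε ^ 2) := by ring
  rw [e₂, e₃]
  nlinarith

lemma admissibleScalar_sqrt_two_mul {ε : ℝ} {ψ : ℂ → ℂ} {g : ℂ → ℝ}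
    (hc : ContinuousOn ψ (closedBall 0 1)) (hd : ContDiffOn ℝ 1 ψ (ball 0 1))
    (hb : ∀ x : ℂ, ‖x‖ = 1 → ψ x = (Real.sqrt 2 : ℂ)⁻¹ * x ^ 1)
    (hg : IntegrableOn g (ball 0 1))
    (hle : ∀ x, gDen ε (fun y => (Real.sqrt 2 : ℂ) * ψ y) x ≤ g x) :
    AdmissibleScalar ε (fun y => (Real.sqrt 2 : ℂ) * ψ y) := by
  have hd' : ContDiffOn ℝ 1 (fun y => (Real.sqrt 2 : ℂ) * ψ y) (ball 0 1) := contDiffOn_const.mul hd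
  refine ⟨continuousOn_const.mul hc, hd', ?_, fun x hx => ?_⟩
  · refine Integrable.mono' hg
      ((continuousOn_gDen ε hd').aestronglyMeasurable measurableSet_ball)
      (Eventually.of_forall fun x => ?_)
    rw [Real.norm_of_nonneg (gDen_nonneg _ _ _)]
    exact hle x
  · beta_reduce
    rw [hb x hx, pow_one, mul_inv_cancel_left₀ sqrt_two_ne_zero]

lemma integrableOn_gDen_of_contDiff {u : ℂ → ℂ} (ε : ℝ) (hu : ContDiff ℝ 1 u) :
    IntegrableOn (gDen ε u) (ball 0 1) := by
  have hf : Continuous (fderiv ℝ u) := hu.continuous_fderiv one_ne_zero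
  have hu' := hu.continuous
  have : Continuous (gDen ε u) := by
    unfold gDen gradSq
    fun_prop
  exact (this.continuousOn.integrableOn_compact (isCompact_closedBall 0 1)).mono_set
    ball_subset_closedBall

lemma integrableOn_eDen_of_contDiff {ψp ψm : ℂ → ℂ} (ε β : ℝ) (hp : ContDiff ℝ 1 ψp)
    (hm : ContDiff ℝ 1 ψm) : IntegrableOn (eDen ε β ψp ψm) (ball 0 1) := by
  have hp₁ : Continuous (fderiv ℝ ψp) := hp.continuous_fderiv one_ne_zero
  have hm₁ : Continuous (fderiv ℝ ψm) := hm.continuous_fderiv one_ne_zero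
  have hp₀ := hp.continuous
  have hm₀ := hm.continuous
  have : Continuous (eDen ε β ψp ψm) := by
    unfold eDen gradSq
    fun_prop
  exact (this.continuousOn.integrableOn_compact (isCompact_closedBall 0 1)).mono_set
    ball_subset_closedBall

lemma exists_admissiblePair (ε β : ℝ) (np nm : ℕ) :
    ∃ ψp ψm : ℂ → ℂ, AdmissiblePair ε β np nm ψp ψm := by
  have h (n : ℕ) : ContDiff ℝ 1 fun x : ℂ => (Real.sqrt 2 : ℂ)⁻¹ * x ^ n := by fun_prop
  exact ⟨_, _, (h np).continuous.continuousOn, (h nm).continuous.continuousOn,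
    (h np).contDiffOn, (h nm).contDiffOn, integrableOn_eDen_of_contDiff ε β (h np) (h nm),
    fun x _ => ⟨rfl, rfl⟩⟩

lemma exists_admissibleScalar (ε : ℝ) : ∃ u : ℂ → ℂ, AdmissibleScalar ε u := by
  have h : ContDiff ℝ 1 fun x : ℂ => x := contDiff_id
  exact ⟨_, h.continuous.continuousOn, h.contDiffOn, integrableOn_gDen_of_contDiff ε h,
    fun x _ => rfl⟩

lemma IGL_le_two_mul_Ival_one {ε β δ : ℝ} (nm : ℕ) (hβ : 0 < β)
    (hδ : 1 / δ ^ 2 = 2 * β / (1 + β) * (1 / ε ^ 2)) :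
    IGL δ ≤ 2 * Ival ε β 1 nm := by
  suffices IGL δ / 2 ≤ Ival ε β 1 nm by linarith
  obtain ⟨φp, φm, hφ⟩ := exists_admissiblePair ε β 1 nm
  refine le_csInf ⟨_, φp, φm, hφ, rfl⟩ ?_
  rintro e ⟨ψp, ψm, ⟨hcp, -, hdp, -, hint, hb⟩, rfl⟩
  have hle := gDen_le_two_mul_eDen hβ hδ ψp ψm
  have hu := admissibleScalar_sqrt_two_mul hcp hdp (fun x hx => (hb x hx).1)
    (hint.const_mul 2) hle
  have h₁ : IGL δ ≤ Gn δ (fun y => (Real.sqrt 2 : ℂ) * ψp y) :=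
    csInf_le (bddBelow_scalarEnergies δ) ⟨_, hu, rfl⟩
  have h₂ : Gn δ (fun y => (Real.sqrt 2 : ℂ) * ψp y) ≤ 2 * En ε β ψp ψm := by
    rw [Gn, En, ← integral_const_mul]
    exact integral_mono hu.2.2.1 (hint.const_mul 2) hle
  linarith

lemma Ival_one_one_eq_IGL {β : ℝ} (hβ : 1 ≤ β) (ε : ℝ) : Ival ε β 1 1 = IGL ε := by
  apply le_antisymm
  · obtain ⟨w, hw⟩ := exists_admissibleScalar ε
    refine le_csInf ⟨_, w, hw, rfl⟩ ?_
    rintro e ⟨u, ⟨hc, hd, hint, hb⟩, rfl⟩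
    have hden : eDen ε β (fun y => (Real.sqrt 2 : ℂ)⁻¹ * u y) (fun y => (Real.sqrt 2 : ℂ)⁻¹ * u y) = gDen ε u :=
      funext (eDen_diagonal ε β u)
    have hc' : ContinuousOn (fun y => (Real.sqrt 2 : ℂ)⁻¹ * u y) (closedBall 0 1) :=
      continuousOn_const.mul hc
    have hd' : ContDiffOn ℝ 1 (fun y => (Real.sqrt 2 : ℂ)⁻¹ * u y) (ball 0 1) :=
      contDiffOn_const.mul hd
    refine csInf_le (bddBelow_pairEnergies (by linarith) ε 1 1)
      ⟨_, _, ⟨hc', hc', hd', hd', hden ▸ hint, fun x hx => ?_⟩, ?_⟩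
    · simp [hb x hx]
    · rw [En, Gn, hden]
  · obtain ⟨φp, φm, hφ⟩ := exists_admissiblePair ε β 1 1
    refine le_csInf ⟨_, φp, φm, hφ, rfl⟩ ?_
    rintro e ⟨ψp, ψm, ⟨hcp, hcm, hdp, hdm, hint, hb⟩, rfl⟩
    have hle := gDen_add_gDen_le_two_mul_eDen hβ ε ψp ψm
    have hp := admissibleScalar_sqrt_two_mul (ε := ε) hcp hdp (fun x hx => (hb x hx).1)
      (hint.const_mul 2)
      fun x => by linarith [hle x, gDen_nonneg ε (fun y => (Real.sqrt 2 : ℂ) * ψm y) x]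
    have hm := admissibleScalar_sqrt_two_mul (ε := ε) hcm hdm (fun x hx => (hb x hx).2)
      (hint.const_mul 2)
      fun x => by linarith [hle x, gDen_nonneg ε (fun y => (Real.sqrt 2 : ℂ) * ψp y) x]
    have h₁ : IGL ε ≤ Gn ε (fun y => (Real.sqrt 2 : ℂ) * ψp y) :=
      csInf_le (bddBelow_scalarEnergies ε) ⟨_, hp, rfl⟩
    have h₂ : IGL ε ≤ Gn ε (fun y => (Real.sqrt 2 : ℂ) * ψm y) :=
      csInf_le (bddBelow_scalarEnergies ε) ⟨_, hm, rfl⟩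
    have h₃ : Gn ε (fun y => (Real.sqrt 2 : ℂ) * ψp y) + Gn ε (fun y => (Real.sqrt 2 : ℂ) * ψm y)
        ≤ 2 * En ε β ψp ψm := by
      rw [Gn, Gn, En, ← integral_const_mul, ← integral_add hp.2.2.1 hm.2.2.1]
      exact integral_mono (hp.2.2.1.add hm.2.2.1) (hint.const_mul 2) hle
    linarith

/-- For `β > 1`: if the core energies `Q_GL` and `Q_{[1,0]}(β)` exist, then
`Q_GL < 2·Q_{[1,0]}(β)`; and if the limit defining `Q_{[1,1]}(β)` also exists,
then `Q_{[1,1]}(β) = Q_GL`. -/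
theorem statement2 (β QGL Q10 : ℝ) (hβ : 1 < β)
    (hQGL : Tendsto (fun ε => IGL ε - Real.pi * Real.log (1 / ε))
      (nhdsWithin 0 (Ioi 0)) (nhds QGL))
    (hQ10 : Tendsto (fun ε => Ival ε β 1 0 - (Real.pi / 2) * Real.log (1 / ε))
      (nhdsWithin 0 (Ioi 0)) (nhds Q10)) :
    QGL < 2 * Q10 ∧
      ∀ Q11 : ℝ,
        Tendsto (fun ε => Ival ε β 1 1 - Real.pi * Real.log (1 / ε))
          (nhdsWithin 0 (Ioi 0)) (nhds Q11) →
        Q11 = QGL := by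
  constructor
  · set lam : ℝ := 2 * β / (1 + β) with hlam
    have hlam₁ : 1 < lam := by rw [hlam, lt_div_iff₀ (by linarith)]; linarith
    have hlam₀ : 0 < lam := by linarith
    have hs : 0 < Real.sqrt lam := Real.sqrt_pos.2 hlam₀
    have hlog : 0 < Real.log (Real.sqrt lam) :=
      Real.log_pos (by rw [Real.lt_sqrt zero_le_one]; simpa using hlam₁)
    have hscale : Tendsto (fun ε : ℝ => ε / Real.sqrt lam) (nhdsWithin 0 (Ioi 0))
        (nhdsWithin 0 (Ioi 0)) := by
      refine tendsto_nhdsWithin_iff.2 ⟨?_, ?_⟩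
      · have h : Continuous fun ε : ℝ => ε / Real.sqrt lam := by fun_prop
        simpa using (h.tendsto 0).mono_left nhdsWithin_le_nhds
      · filter_upwards [self_mem_nhdsWithin] with ε hε
        exact div_pos hε hs
    have hlow := (hQGL.comp hscale).add_const (Real.pi * Real.log (Real.sqrt lam))
    have hlim : QGL + Real.pi * Real.log (Real.sqrt lam) ≤ 2 * Q10 := by
      refine le_of_tendsto_of_tendsto hlow (hQ10.const_mul 2) ?_
      filter_upwards [self_mem_nhdsWithin] with ε (hε : 0 < ε)
      have h := IGL_le_two_mul_Ival_one (ε := ε) (β := β) (δ := ε / Real.sqrt lam) 0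
        (by linarith) (by
          rw [div_pow, Real.sq_sqrt hlam₀.le, one_div_div, ← hlam]; ring)
      have e : Real.log (1 / (ε / Real.sqrt lam))
          = Real.log (1 / ε) + Real.log (Real.sqrt lam) := by
        rw [← Real.log_mul (by positivity) hs.ne']
        congr 1
        field_simp
      simp only [Function.comp_apply, e]
      linarith
    have := mul_pos Real.pi_pos hlog
    linarith
  · intro Q11 h
    simp only [Ival_one_one_eq_IGL hβ.le] at h
    exact tendsto_nhds_unique h hQGL
end
end

section
/- Let β > 0 and let Ψ be a C² entire solution of the two-component Ginzburg–Landau system that has degree pair [n₊,n₋] at infinity with standard asymptotics. Then there exists L ∈ ℝ such that E(Ψ;B_R) − (π/2)·(n₊² + n₋²)·log R → L as R → ∞, where B_R is the open ball of radius R centered at the origin. -/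
open MeasureTheory Metric Set Filter Complex

noncomputable section

/-- The Laplacian of `f : ℂ → ℂ` (plane identified with `ℂ`). -/
def lap (f : ℂ → ℂ) (x : ℂ) : ℂ :=
  fderiv ℝ (fun y => fderiv ℝ f y 1) x 1 + fderiv ℝ (fun y => fderiv ℝ f y Complex.I) x Complex.I

/-- `Ψ = (ψ₊,ψ₋)` is a `C²` entire solution of the two-component Ginzburg–Landau system
with the integrability condition. -/
def EntireSolution (β : ℝ) (ψp ψm : ℂ → ℂ) : Prop :=
  ContDiff ℝ 2 ψp ∧ ContDiff ℝ 2 ψm ∧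
  (∀ x : ℂ, -lap ψp x =
      ((1 - (‖ψp x‖ ^ 2 + ‖ψm x‖ ^ 2) : ℝ) : ℂ) * ψp x
        + (β : ℂ) * ((‖ψm x‖ ^ 2 - ‖ψp x‖ ^ 2 : ℝ) : ℂ) * ψp x) ∧
  (∀ x : ℂ, -lap ψm x =
      ((1 - (‖ψp x‖ ^ 2 + ‖ψm x‖ ^ 2) : ℝ) : ℂ) * ψm x
        - (β : ℂ) * ((‖ψm x‖ ^ 2 - ‖ψp x‖ ^ 2 : ℝ) : ℂ) * ψm x) ∧
  Integrable (fun x : ℂ =>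
    ((‖ψp x‖ ^ 2 + ‖ψm x‖ ^ 2 - 1) ^ 2 + β * (‖ψp x‖ ^ 2 - ‖ψm x‖ ^ 2) ^ 2))

/-- Ginzburg–Landau energy density with `ε = 1`. -/
def eDen1 (β : ℝ) (ψp ψm : ℂ → ℂ) (x : ℂ) : ℝ :=
  (1 / 2) * (gradSq ψp x + gradSq ψm x)
    + (1 / 4) * ((‖ψp x‖ ^ 2 + ‖ψm x‖ ^ 2 - 1) ^ 2)
    + (β / 4) * ((‖ψp x‖ ^ 2 - ‖ψm x‖ ^ 2) ^ 2)

/-- Energy of `Ψ` on a set `Ω`. -/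
def Eloc (β : ℝ) (ψp ψm : ℂ → ℂ) (Ω : Set ℂ) : ℝ := ∫ x in Ω, eDen1 β ψp ψm x

/-- `Ψ` has degree pair `[np, nm]` at infinity with the standard asymptotics. -/
def HasDegreeAtInfty (np nm : ℤ) (ψp ψm : ℂ → ℂ) : Prop :=
  ∃ R₀ > (0 : ℝ), ∃ c > (0 : ℝ), ∃ φp φm : ℝ, ∃ ρp ρm χp χm : ℂ → ℝ,
    ContDiffOn ℝ 1 ρp {x : ℂ | R₀ ≤ ‖x‖} ∧ ContDiffOn ℝ 1 ρm {x : ℂ | R₀ ≤ ‖x‖} ∧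
    ContDiffOn ℝ 1 χp {x : ℂ | R₀ ≤ ‖x‖} ∧ ContDiffOn ℝ 1 χm {x : ℂ | R₀ ≤ ‖x‖} ∧
    (∀ x : ℂ, R₀ ≤ ‖x‖ → 0 < ρp x ∧ 0 < ρm x) ∧
    (∀ x : ℂ, R₀ ≤ ‖x‖ →
      ψp x = (ρp x : ℂ) *
          Complex.exp (Complex.I * (((np : ℝ) * Complex.arg x + χp x : ℝ) : ℂ)) ∧
      ψm x = (ρm x : ℂ) *
          Complex.exp (Complex.I * (((nm : ℝ) * Complex.arg x + χm x : ℝ) : ℂ))) ∧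
    (∀ x : ℂ, R₀ ≤ ‖x‖ →
      |ρp x - 1 / Real.sqrt 2| ≤ c / ‖x‖ ^ 2 ∧ |ρm x - 1 / Real.sqrt 2| ≤ c / ‖x‖ ^ 2) ∧
    (∀ x : ℂ, R₀ ≤ ‖x‖ →
      ‖fderiv ℝ ρp x‖ ≤ c / ‖x‖ ^ 3 ∧ ‖fderiv ℝ ρm x‖ ≤ c / ‖x‖ ^ 3) ∧
    IntegrableOn (fun x : ℂ =>
        ‖fderiv ℝ ρp x‖ ^ 2 + ‖fderiv ℝ ρm x‖ ^ 2
          + ‖fderiv ℝ χp x‖ ^ 2 + ‖fderiv ℝ χm x‖ ^ 2)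
      {x : ℂ | R₀ ≤ ‖x‖} ∧
    (∀ δ > (0 : ℝ), ∃ M : ℝ, ∀ x : ℂ, M ≤ ‖x‖ → |χp x - φp| < δ ∧ |χm x - φm| < δ)

/-- `Ψ` is a locally minimizing solution (in the sense of De Giorgi). -/
def LocallyMinimizing (β : ℝ) (ψp ψm : ℂ → ℂ) : Prop :=
  ∀ R > (0 : ℝ), ∀ Φp Φm : ℂ → ℂ,
    ContinuousOn Φp (closedBall 0 R) → ContinuousOn Φm (closedBall 0 R) →
    ContDiffOn ℝ 1 Φp (ball 0 R) → ContDiffOn ℝ 1 Φm (ball 0 R) →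
    (∀ x : ℂ, ‖x‖ = R → Φp x = ψp x ∧ Φm x = ψm x) →
    Eloc β ψp ψm (ball 0 R) ≤ Eloc β Φp Φm (ball 0 R)

/-- `⟨∇ arg, ∇ χ⟩`: the angular derivative of `χ` divided by `‖x‖ ^ 2`. -/
def angularGrad (χ : ℂ → ℝ) (x : ℂ) : ℝ :=
  (x.re * fderiv ℝ χ x Complex.I - x.im * fderiv ℝ χ x 1) / ‖x‖ ^ 2

lemma measurable_angularGrad (χ : ℂ → ℝ) : Measurable (angularGrad χ) := by
  have h1 := measurable_fderiv_apply_const ℝ χ 1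
  have h2 := measurable_fderiv_apply_const ℝ χ Complex.I
  unfold angularGrad
  fun_prop

lemma measurable_gradSq (f : ℂ → ℂ) : Measurable (gradSq f) := by
  have h1 := measurable_fderiv_apply_const ℝ f 1
  have h2 := measurable_fderiv_apply_const ℝ f Complex.I
  unfold gradSq
  fun_prop

lemma abs_angularGrad_le {χ : ℂ → ℝ} {x : ℂ} (hx : 0 < ‖x‖) :
    |angularGrad χ x| ≤ 2 * ‖fderiv ℝ χ x‖ / ‖x‖ := by
  have h1 := (fderiv ℝ χ x).le_opNorm 1
  have h2 := (fderiv ℝ χ x).le_opNorm Complex.I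
  simp only [norm_one, Complex.norm_I, mul_one, Real.norm_eq_abs] at h1 h2
  have hr := Complex.abs_re_le_norm x
  have hi := Complex.abs_im_le_norm x
  unfold angularGrad
  rw [abs_div, abs_of_pos (pow_pos hx 2), div_le_div_iff₀ (pow_pos hx 2) hx]
  have h3 : |x.re * fderiv ℝ χ x Complex.I - x.im * fderiv ℝ χ x 1|
      ≤ ‖x‖ * ‖fderiv ℝ χ x‖ + ‖x‖ * ‖fderiv ℝ χ x‖ := by
    refine (abs_sub _ _).trans ?_
    rw [abs_mul, abs_mul]
    gcongr
  nlinarith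

lemma gradSq_polar {ψ : ℂ → ℂ} {ρ χ : ℂ → ℝ} {n : ℝ} {x : ℂ} (hx : x ∈ slitPlane)
    (hρ : DifferentiableAt ℝ ρ x) (hχ : DifferentiableAt ℝ χ x)
    (h : ψ =ᶠ[nhds x] fun y =>
      (ρ y : ℂ) * Complex.exp (Complex.I * ((n * Complex.arg y + χ y : ℝ) : ℂ))) :
    gradSq ψ x = (fderiv ℝ ρ x 1) ^ 2 + (fderiv ℝ ρ x Complex.I) ^ 2
      + ρ x ^ 2 * (n ^ 2 / ‖x‖ ^ 2 + 2 * n * angularGrad χ x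
        + ((fderiv ℝ χ x 1) ^ 2 + (fderiv ℝ χ x Complex.I) ^ 2)) := by
  have harg : HasFDerivAt Complex.arg
      (Complex.imCLM.comp (x⁻¹ • (1 : ℂ →L[ℝ] ℂ))) x := by
    have := Complex.imCLM.hasFDerivAt.comp x (hasStrictFDerivAt_log_real hx).hasFDerivAt
    refine this.congr_of_eventuallyEq (Eventually.of_forall fun y => ?_)
    simp [Complex.log_im]
  have ha : HasFDerivAt (fun y => n * Complex.arg y + χ y)
      (n • (Complex.imCLM.comp (x⁻¹ • (1 : ℂ →L[ℝ] ℂ))) + fderiv ℝ χ x) x :=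
    (harg.const_mul n).add hχ.hasFDerivAt
  have hexp := ((Complex.ofRealCLM.hasFDerivAt.comp x ha).const_mul Complex.I).cexp
  have hψ := ((Complex.ofRealCLM.hasFDerivAt.comp x hρ.hasFDerivAt).mul hexp).congr_of_eventuallyEq h
  have key : ∀ v : ℂ, ‖fderiv ℝ ψ x v‖ ^ 2 =
      (fderiv ℝ ρ x v) ^ 2 + ρ x ^ 2 * (n * (x⁻¹ * v).im + fderiv ℝ χ x v) ^ 2 := by
    intro v
    have e : fderiv ℝ ψ x v =
        ((fderiv ℝ ρ x v : ℂ) + ((ρ x * (n * (x⁻¹ * v).im + fderiv ℝ χ x v) : ℝ) : ℂ) * Complex.I)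
          * Complex.exp (((n * Complex.arg x + χ x : ℝ) : ℂ) * Complex.I) := by
      rw [hψ.fderiv]
      simp [-Complex.mul_im]
      ring_nf
    rw [e, norm_mul, Complex.norm_exp_ofReal_mul_I, mul_one, ← Complex.normSq_eq_norm_sq,
      Complex.normSq_add_mul_I]
    ring
  have hx0 : x ≠ 0 := slitPlane_ne_zero hx
  have hN : ‖x‖ ^ 2 = x.re ^ 2 + x.im ^ 2 := by
    rw [← Complex.normSq_eq_norm_sq, Complex.normSq_apply]; ring
  have hN0 : x.re ^ 2 + x.im ^ 2 ≠ 0 := by rw [← hN]; positivity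
  unfold gradSq angularGrad
  rw [key, key]
  have e1 : (x⁻¹ * 1).im = - x.im / (x.re ^ 2 + x.im ^ 2) := by
    rw [mul_one, Complex.inv_im, Complex.normSq_eq_norm_sq, hN]
  have e2 : (x⁻¹ * Complex.I).im = x.re / (x.re ^ 2 + x.im ^ 2) := by
    simp [Complex.inv_re, Complex.normSq_eq_norm_sq, hN]
  rw [e1, e2, hN]
  field_simp
  ring

lemma integral_angularGrad_annulus {χ : ℂ → ℝ} {a b : ℝ}
    (hχ : ∀ x : ℂ, a ≤ ‖x‖ → DifferentiableAt ℝ χ x) :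
    ∫ x in {x : ℂ | a ≤ ‖x‖} ∩ ball 0 b, angularGrad χ x = 0 := by
  have hms : MeasurableSet ({x : ℂ | a ≤ ‖x‖} ∩ ball 0 b) :=
    (measurableSet_le measurable_const measurable_norm).inter measurableSet_ball
  rw [← integral_indicator hms, ← Complex.integral_comp_polarCoord_symm]
  by_cases hint : IntegrableOn (fun p : ℝ × ℝ => p.1 •
      ({x : ℂ | a ≤ ‖x‖} ∩ ball 0 b).indicator (angularGrad χ) (Complex.polarCoord.symm p))
      (Ioi (0 : ℝ) ×ˢ Ioo (-Real.pi) Real.pi)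
  swap
  · exact integral_undef hint
  change ∫ p in (Ioi (0 : ℝ) ×ˢ Ioo (-Real.pi) Real.pi), _ = 0
  rw [Measure.volume_eq_prod] at hint ⊢
  rw [setIntegral_prod _ hint]
  refine setIntegral_eq_zero_of_forall_eq_zero fun r hr => ?_
  have hr0 : (0 : ℝ) < r := hr
  have hmem : ∀ θ : ℝ, (Complex.polarCoord.symm (r, θ) ∈ {x : ℂ | a ≤ ‖x‖} ∩ ball 0 b) ↔
      (a ≤ r ∧ r < b) := by
    intro θ
    rw [mem_inter_iff, mem_ofPred_eq, mem_ball_zero_iff, Complex.norm_polarCoord_symm,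
      abs_of_pos hr0]
  by_cases hab : a ≤ r ∧ r < b
  swap
  · refine setIntegral_eq_zero_of_forall_eq_zero fun θ _ => ?_
    rw [indicator_of_notMem (fun h => hab ((hmem θ).1 h)), smul_zero]
  have hd : ∀ θ : ℝ, HasDerivAt (fun t : ℝ => r⁻¹ * χ (Complex.polarCoord.symm (r, t)))
      (r * angularGrad χ (Complex.polarCoord.symm (r, θ))) θ := by
    intro θ
    have hc : HasDerivAt (fun t : ℝ => Complex.polarCoord.symm (r, t))
        ((r : ℂ) * (-Real.sin θ + Real.cos θ * Complex.I)) θ := by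
      have h1 := (Real.hasDerivAt_cos θ).ofReal_comp
      have h2 := ((Real.hasDerivAt_sin θ).ofReal_comp).mul_const Complex.I
      have h3 := (h1.add h2).const_mul (r : ℂ)
      refine (h3.congr_deriv (by simp)).congr_of_eventuallyEq
        (Eventually.of_forall fun t => by simp)
    have hdx := (hχ _ ((hmem θ).2 hab).1).hasFDerivAt.comp_hasDerivAt θ hc
    have h4 := hdx.const_mul r⁻¹
    refine h4.congr_deriv ?_
    have hv : ((r : ℂ) * (-Real.sin θ + Real.cos θ * Complex.I)) =
        (-(r * Real.sin θ)) • (1 : ℂ) + (r * Real.cos θ) • Complex.I := by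
      simp; ring
    rw [hv, map_add, map_smul, map_smul]
    unfold angularGrad
    rw [Complex.norm_polarCoord_symm, abs_of_pos hr0]
    have hre : (Complex.polarCoord.symm (r, θ)).re = r * Real.cos θ := by
      simp [-Complex.ofReal_cos, -Complex.ofReal_sin]
    have him : (Complex.polarCoord.symm (r, θ)).im = r * Real.sin θ := by
      simp [-Complex.ofReal_cos, -Complex.ofReal_sin]
    rw [hre, him]
    simp only [smul_eq_mul]
    field_simp
    ring
  have hcongr : ∀ θ : ℝ, r • ({x : ℂ | a ≤ ‖x‖} ∩ ball 0 b).indicator (angularGrad χ)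
      (Complex.polarCoord.symm (r, θ)) = r * angularGrad χ (Complex.polarCoord.symm (r, θ)) := by
    intro θ
    rw [indicator_of_mem ((hmem θ).2 hab), smul_eq_mul]
  simp only [hcongr]
  rw [← integral_Ioc_eq_integral_Ioo,
    ← intervalIntegral.integral_of_le (by linarith [Real.pi_pos])]
  by_cases hi : IntervalIntegrable
      (fun θ => r * angularGrad χ (Complex.polarCoord.symm (r, θ))) volume (-Real.pi) Real.pi
  · rw [intervalIntegral.integral_eq_sub_of_hasDerivAt (fun θ _ => hd θ) hi]
    simp
  · exact intervalIntegral.integral_undef hi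

lemma integral_norm_sq_inv_annulus {a b : ℝ} (ha : 0 < a) (hab : a ≤ b) :
    ∫ x in {x : ℂ | a ≤ ‖x‖} ∩ ball 0 b, 1 / ‖x‖ ^ 2 = 2 * Real.pi * Real.log (b / a) := by
  have hms : MeasurableSet ({x : ℂ | a ≤ ‖x‖} ∩ ball 0 b) :=
    (measurableSet_le measurable_const measurable_norm).inter measurableSet_ball
  have hind : ({x : ℂ | a ≤ ‖x‖} ∩ ball 0 b).indicator (fun x : ℂ => 1 / ‖x‖ ^ 2) =
      fun x : ℂ => (Ico a b).indicator (fun r : ℝ => 1 / r ^ 2) ‖x‖ := by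
    funext x
    simp only [indicator, mem_inter_iff, mem_ofPred_eq, mem_ball_zero_iff, mem_Ico]
  rw [← integral_indicator hms, hind, integral_fun_norm_addHaar]
  have hvol : (volume : Measure ℂ).real (ball 0 1) = Real.pi := by
    simp [Measure.real, Complex.volume_ball]
  rw [hvol, Complex.finrank_real_complex]
  have hcongr : ∀ y : ℝ, y ^ (2 - 1) • (Ico a b).indicator (fun r : ℝ => 1 / r ^ 2) y =
      (Ico a b).indicator (fun r : ℝ => r⁻¹) y := by
    intro y
    by_cases hy : y ∈ Ico a b
    · rw [indicator_of_mem hy, indicator_of_mem hy]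
      have : y ≠ 0 := (ha.trans_le hy.1).ne'
      rw [smul_eq_mul, show 2 - 1 = 1 from rfl, pow_one]
      field_simp
    · rw [indicator_of_notMem hy, indicator_of_notMem hy, smul_zero]
  simp only [hcongr]
  rw [setIntegral_indicator measurableSet_Ico,
    inter_eq_right.2 (fun y hy => mem_Ioi.2 (ha.trans_le hy.1)), integral_Ico_eq_integral_Ioo,
    ← integral_Ioc_eq_integral_Ioo, ← intervalIntegral.integral_of_le hab,
    integral_inv_of_pos ha (ha.trans_le hab)]
  simp only [nsmul_eq_mul, smul_eq_mul]
  push_cast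
  ring

lemma integrableOn_norm_pow_neg_four {a : ℝ} (ha : 1 ≤ a) :
    IntegrableOn (fun x : ℂ => 1 / ‖x‖ ^ 4) {x : ℂ | a ≤ ‖x‖} := by
  have hJ : Integrable (fun x : ℂ => 16 * (1 + ‖x‖) ^ (-(4 : ℝ))) :=
    (integrable_one_add_norm (by rw [Complex.finrank_real_complex]; norm_num)).const_mul 16
  refine hJ.integrableOn.mono' (Measurable.aestronglyMeasurable (by fun_prop)) ?_
  refine (ae_restrict_iff' (measurableSet_le measurable_const measurable_norm)).2
    (Eventually.of_forall fun x hx => ?_)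
  have h1 : 1 ≤ ‖x‖ := ha.trans hx
  rw [Real.rpow_neg (by positivity), Real.norm_of_nonneg (by positivity),
    show (4 : ℝ) = ((4 : ℕ) : ℝ) by norm_num, Real.rpow_natCast, ← div_eq_mul_inv,
    div_le_div_iff₀ (by positivity) (by positivity)]
  calc 1 * (1 + ‖x‖) ^ 4 ≤ 1 * (2 * ‖x‖) ^ 4 := by gcongr; linarith
    _ = 16 * ‖x‖ ^ 4 := by ring

lemma ae_mem_slitPlane : ∀ᵐ x : ℂ, x ∈ slitPlane := by
  have h := (Complex.volume_preserving_equiv_real_prod.quasiMeasurePreserving).ae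
    (eventuallyEq_univ.1 polarCoord_source_ae_eq_univ)
  filter_upwards [h] with x hx
  exact hx

lemma abs_gradSq_remainder_le {r P₁ P₂ X₁ X₂ T p q n C N : ℝ} (hN : 1 ≤ N) (hC : 0 ≤ C)
    (hP₁ : |P₁| ≤ p) (hP₂ : |P₂| ≤ p) (hX₁ : |X₁| ≤ q) (hX₂ : |X₂| ≤ q)
    (hT : |T| ≤ 2 * q / N) (hr : |r - 1 / 2| ≤ C / N ^ 2) :
    |P₁ ^ 2 + P₂ ^ 2 + r * (n ^ 2 / N ^ 2 + 2 * n * T + (X₁ ^ 2 + X₂ ^ 2))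
        - (n ^ 2 / 2 * (1 / N ^ 2) + n * T)|
      ≤ (2 + 2 * (1 + C) ^ 2 * (1 + n ^ 2)) * 3 * (p ^ 2 + q ^ 2 + 1 / N ^ 4) := by
  have hN0 : 0 < N := by linarith
  have hp : 0 ≤ p := (abs_nonneg _).trans hP₁
  have hq : 0 ≤ q := (abs_nonneg _).trans hX₁
  set u : ℝ := 1 / N with hu
  have hu0 : 0 ≤ u := by positivity
  have hu1 : u ≤ 1 := by rw [hu, div_le_one hN0]; exact hN
  have e4 : 1 / N ^ 4 = (u ^ 2) ^ 2 := by rw [hu]; field_simp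
  have e2 : n ^ 2 / N ^ 2 = n ^ 2 * u ^ 2 := by rw [hu]; field_simp
  have e2' : 1 / N ^ 2 = u ^ 2 := by rw [hu]; field_simp
  have eC : C / N ^ 2 = C * u ^ 2 := by rw [hu]; field_simp
  have eT : 2 * q / N = 2 * q * u := by rw [hu]; field_simp
  rw [eC] at hr
  rw [eT] at hT
  rw [e4, e2, e2']
  set w : ℝ := u ^ 2 with hw
  have hw0 : 0 ≤ w := by positivity
  have hw1 : w ≤ 1 := by rw [hw]; exact pow_le_one₀ hu0 hu1
  have hT' : |T| ≤ 2 * q := hT.trans (by nlinarith)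
  have hrw : |r - 1 / 2| ≤ C := hr.trans (by nlinarith)
  have hP : P₁ ^ 2 + P₂ ^ 2 ≤ 2 * p ^ 2 := by
    have := sq_le_sq' (abs_le.1 hP₁).1 (abs_le.1 hP₁).2
    have := sq_le_sq' (abs_le.1 hP₂).1 (abs_le.1 hP₂).2
    linarith
  have hX : X₁ ^ 2 + X₂ ^ 2 ≤ 2 * q ^ 2 := by
    have := sq_le_sq' (abs_le.1 hX₁).1 (abs_le.1 hX₁).2
    have := sq_le_sq' (abs_le.1 hX₂).1 (abs_le.1 hX₂).2
    linarith
  have hr' : |r| ≤ 1 / 2 + C := by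
    rw [abs_le] at hrw ⊢
    constructor <;> linarith [hrw.1, hrw.2]
  have A1 : |(r - 1 / 2) * (n ^ 2 * w)| ≤ C * n ^ 2 * w ^ 2 := by
    rw [abs_mul, abs_of_nonneg (by positivity : 0 ≤ n ^ 2 * w)]
    calc |r - 1 / 2| * (n ^ 2 * w) ≤ (C * w) * (n ^ 2 * w) := by gcongr
      _ = _ := by ring
  have A2 : |(r - 1 / 2) * (2 * n * T)| ≤ 2 * C * (1 + n ^ 2) * (w ^ 2 + q ^ 2) := by
    rw [abs_mul, abs_mul, abs_mul, abs_two]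
    have hn : 2 * |n| ≤ 1 + n ^ 2 := by nlinarith [sq_nonneg (|n| - 1), sq_abs n]
    calc |r - 1 / 2| * (2 * |n| * |T|) ≤ (C * w) * ((1 + n ^ 2) * (2 * q)) := by gcongr
      _ = C * (1 + n ^ 2) * (2 * w * q) := by ring
      _ ≤ C * (1 + n ^ 2) * (w ^ 2 + q ^ 2) := by
          gcongr; nlinarith [sq_nonneg (w - q)]
      _ ≤ 2 * C * (1 + n ^ 2) * (w ^ 2 + q ^ 2) := by
          have : 0 ≤ C * (1 + n ^ 2) * (w ^ 2 + q ^ 2) := by positivity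
          linarith
  have A3 : |r * (X₁ ^ 2 + X₂ ^ 2)| ≤ (1 / 2 + C) * (2 * q ^ 2) := by
    rw [abs_mul, abs_of_nonneg (by positivity : 0 ≤ X₁ ^ 2 + X₂ ^ 2)]
    gcongr
  have A0 : |P₁ ^ 2 + P₂ ^ 2| ≤ 2 * p ^ 2 := by rwa [abs_of_nonneg (by positivity)]
  have split : P₁ ^ 2 + P₂ ^ 2 + r * (n ^ 2 * w + 2 * n * T + (X₁ ^ 2 + X₂ ^ 2))
        - (n ^ 2 / 2 * w + n * T) = (P₁ ^ 2 + P₂ ^ 2) + (r - 1 / 2) * (n ^ 2 * w)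
        + (r - 1 / 2) * (2 * n * T) + r * (X₁ ^ 2 + X₂ ^ 2) := by ring
  rw [split]
  refine (abs_add_le _ _).trans ((add_le_add ((abs_add_le _ _).trans
    (add_le_add ((abs_add_le _ _).trans (add_le_add A0 A1)) A2)) A3).trans ?_)
  have hK : 1 / 2 + C ≤ (1 + C) ^ 2 := by linarith [sq_nonneg C, add_sq 1 C]
  have hK1 : 1 ≤ (1 + C) ^ 2 := one_le_pow₀ (by linarith)
  have hn0 : 0 ≤ n ^ 2 := sq_nonneg n
  have hM1 : 1 ≤ (1 + C) ^ 2 * (1 + n ^ 2) := one_le_mul_of_one_le_of_one_le hK1 (by linarith)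
  have hMC : 1 / 2 + C ≤ (1 + C) ^ 2 * (1 + n ^ 2) :=
    hK.trans (le_mul_of_one_le_right (by positivity) (by linarith))
  have hMn : C * (1 + n ^ 2) ≤ (1 + C) ^ 2 * (1 + n ^ 2) := by
    gcongr; linarith
  have B1 : C * n ^ 2 * w ^ 2 ≤ C * (1 + n ^ 2) * w ^ 2 := by
    gcongr; linarith
  rw [mul_assoc 2 ((1 + C) ^ 2)]
  rw [mul_assoc 2 C]
  generalize (1 + C) ^ 2 * (1 + n ^ 2) = M at *
  generalize C * (1 + n ^ 2) = D at *
  have D1 := mul_le_mul_of_nonneg_right hMn (sq_nonneg w)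
  have D2 := mul_le_mul_of_nonneg_right hMn (sq_nonneg q)
  have D3 := mul_le_mul_of_nonneg_right hMC (sq_nonneg q)
  have D4 := mul_le_mul_of_nonneg_right hM1 (sq_nonneg p)
  have D5 := mul_le_mul_of_nonneg_right hM1 (sq_nonneg q)
  have D6 := mul_le_mul_of_nonneg_right hM1 (sq_nonneg w)
  linarith [sq_nonneg p, sq_nonneg q, sq_nonneg w]

/-- For a map with polar form `ρ exp (i (n θ + χ))` near infinity, the Dirichlet integral over
balls grows like `π n² log R` up to a convergent remainder. -/
lemma exists_tendsto_dirichlet_sub_log {ψ : ℂ → ℂ} {ρ χ : ℂ → ℝ} {n R₀ c : ℝ}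
    (hψ : ContDiff ℝ 2 ψ) (hc : 0 < c)
    (hρ : ContDiffOn ℝ 1 ρ {x : ℂ | R₀ ≤ ‖x‖}) (hχ : ContDiffOn ℝ 1 χ {x : ℂ | R₀ ≤ ‖x‖})
    (hpolar : ∀ x : ℂ, R₀ ≤ ‖x‖ → ψ x =
      (ρ x : ℂ) * Complex.exp (Complex.I * ((n * Complex.arg x + χ x : ℝ) : ℂ)))
    (hρc : ∀ x : ℂ, R₀ ≤ ‖x‖ → |ρ x - 1 / Real.sqrt 2| ≤ c / ‖x‖ ^ 2)
    (hint : IntegrableOn (fun x : ℂ => ‖fderiv ℝ ρ x‖ ^ 2 + ‖fderiv ℝ χ x‖ ^ 2)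
      {x : ℂ | R₀ ≤ ‖x‖}) :
    ∃ L : ℝ, Tendsto (fun R : ℝ => (∫ x in ball 0 R, gradSq ψ x)
      - Real.pi * n ^ 2 * Real.log R) atTop (nhds L) := by
  obtain ⟨a, ha1, haR⟩ : ∃ a : ℝ, 1 ≤ a ∧ R₀ < a :=
    ⟨max 1 (R₀ + 1), le_max_left _ _, (lt_add_one R₀).trans_le (le_max_right _ _)⟩
  have ha0 : 0 < a := by linarith
  set S : Set ℂ := {x : ℂ | a ≤ ‖x‖} with hS
  have hSm : MeasurableSet S := measurableSet_le measurable_const measurable_norm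
  have hnhds : ∀ x ∈ S, {x : ℂ | R₀ ≤ ‖x‖} ∈ nhds x := fun x hx =>
    mem_of_superset ((isOpen_lt continuous_const continuous_norm).mem_nhds (haR.trans_le hx))
      fun y (hy : R₀ < ‖y‖) => hy.le
  have hdρ : ∀ x ∈ S, DifferentiableAt ℝ ρ x := fun x hx =>
    (hρ.contDiffAt (hnhds x hx)).differentiableAt one_ne_zero
  have hdχ : ∀ x ∈ S, DifferentiableAt ℝ χ x := fun x hx =>
    (hχ.contDiffAt (hnhds x hx)).differentiableAt one_ne_zero
  have hgc : Continuous (gradSq ψ) := by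
    have h := hψ.continuous_fderiv two_ne_zero
    unfold gradSq
    fun_prop
  set main : ℂ → ℝ := fun x => n ^ 2 / 2 * (1 / ‖x‖ ^ 2) + n * angularGrad χ x with hmain
  set g : ℂ → ℝ := fun x => gradSq ψ x - main x with hg
  have hmm : Measurable main := by
    have := measurable_angularGrad χ
    fun_prop
  have hgint : IntegrableOn g S := by
    set K : ℝ := (2 + 2 * (1 + c * (2 + c)) ^ 2 * (1 + n ^ 2)) * 3
    have hdom : IntegrableOn (fun x : ℂ => K * (‖fderiv ℝ ρ x‖ ^ 2 + ‖fderiv ℝ χ x‖ ^ 2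
        + 1 / ‖x‖ ^ 4)) S :=
      ((hint.mono_set fun x hx => haR.le.trans hx).add
        (integrableOn_norm_pow_neg_four ha1)).const_mul K
    refine hdom.mono' ((measurable_gradSq ψ).sub hmm).aestronglyMeasurable ?_
    refine (ae_restrict_iff' hSm).2 ?_
    filter_upwards [ae_mem_slitPlane] with x hxs hx
    have hx1 : 1 ≤ ‖x‖ := ha1.trans hx
    have hop : ∀ (f : ℂ → ℝ) (v : ℂ), ‖v‖ = 1 → |fderiv ℝ f x v| ≤ ‖fderiv ℝ f x‖ := by
      intro f v hv
      have := (fderiv ℝ f x).le_opNorm v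
      rwa [hv, mul_one] at this
    have hρ2 : |ρ x ^ 2 - 1 / 2| ≤ c * (2 + c) / ‖x‖ ^ 2 := by
      have hb := hρc x (haR.le.trans hx)
      have hs : (1 / Real.sqrt 2) ^ 2 = 1 / 2 := by
        rw [div_pow, Real.sq_sqrt zero_le_two, one_pow]
      have hs0 : 0 ≤ 1 / Real.sqrt 2 := by positivity
      have hs1 : 1 / Real.sqrt 2 ≤ 1 := by nlinarith
      have hb' : |ρ x - 1 / Real.sqrt 2| ≤ c :=
        hb.trans (div_le_self hc.le (one_le_pow₀ hx1))
      have hsum : |ρ x + 1 / Real.sqrt 2| ≤ 2 + c := by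
        rw [abs_le] at hb' ⊢
        constructor <;> linarith [hb'.1, hb'.2]
      calc |ρ x ^ 2 - 1 / 2| = |ρ x - 1 / Real.sqrt 2| * |ρ x + 1 / Real.sqrt 2| := by
            rw [← abs_mul, ← hs]; congr 1; ring
        _ ≤ c / ‖x‖ ^ 2 * (2 + c) := by gcongr
        _ = _ := by ring
    rw [Real.norm_eq_abs, hg, hmain]
    simp only
    rw [gradSq_polar hxs (hdρ x hx) (hdχ x hx)
      (eventually_of_mem (hnhds x hx) fun y hy => hpolar y hy)]
    exact abs_gradSq_remainder_le hx1 (by positivity) (hop ρ 1 (by simp)) (hop ρ I (by simp))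
      (hop χ 1 (by simp)) (hop χ I (by simp)) (abs_angularGrad_le (by linarith)) hρ2
  have hlim : Tendsto (fun R : ℝ => ∫ x in S ∩ ball 0 R, g x) atTop (nhds (∫ x in S, g x)) := by
    have h := (aecover_ball (μ := (volume : Measure ℂ).restrict S) (x := (0 : ℂ))
      tendsto_id).integral_tendsto_of_countably_generated hgint
    refine h.congr fun R => ?_
    rw [Measure.restrict_restrict measurableSet_ball, inter_comm]
    rfl
  refine ⟨(∫ x in ball 0 a, gradSq ψ x) + (∫ x in S, g x) - Real.pi * n ^ 2 * Real.log a, ?_⟩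
  refine ((hlim.const_add _).sub_const _).congr' ?_
  filter_upwards [eventually_ge_atTop a] with R hR
  have hballint : ∀ r : ℝ, IntegrableOn (gradSq ψ) (ball 0 r) := fun r =>
    (hgc.continuousOn.integrableOn_compact (isCompact_closedBall 0 r)).mono_set
      ball_subset_closedBall
  have hdecomp : ball (0 : ℂ) R = ball 0 a ∪ (S ∩ ball 0 R) := by
    ext x
    simp only [hS, mem_union, mem_inter_iff, mem_ball_zero_iff, mem_ofPred_eq]
    constructor
    · intro h
      rcases lt_or_ge ‖x‖ a with h' | h'
      · exact Or.inl h'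
      · exact Or.inr ⟨h', h⟩
    · rintro (h | h)
      · exact h.trans_le hR
      · exact h.2
  have hdisj : Disjoint (ball (0 : ℂ) a) (S ∩ ball 0 R) :=
    disjoint_left.2 fun x hx hx' => absurd (mem_ball_zero_iff.1 hx) (not_lt.2 hx'.1)
  have hAm : MeasurableSet (S ∩ ball (0 : ℂ) R) := hSm.inter measurableSet_ball
  have hsplit : ∫ x in ball 0 R, gradSq ψ x
      = (∫ x in ball 0 a, gradSq ψ x) + ∫ x in S ∩ ball 0 R, gradSq ψ x := by
    have h := setIntegral_union hdisj hAm (hballint a) ((hballint R).mono_set inter_subset_right)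
    rwa [← hdecomp] at h
  have hgA : IntegrableOn g (S ∩ ball 0 R) := hgint.mono_set inter_subset_left
  have hψA : IntegrableOn (gradSq ψ) (S ∩ ball 0 R) := (hballint R).mono_set inter_subset_right
  have hmainA : IntegrableOn main (S ∩ ball 0 R) :=
    (hψA.sub hgA).congr (Eventually.of_forall fun x => by simp [hg])
  have hinvA : IntegrableOn (fun x : ℂ => n ^ 2 / 2 * (1 / ‖x‖ ^ 2)) (S ∩ ball 0 R) := by
    refine Measure.integrableOn_of_bounded (M := n ^ 2 / 2) ?_
      (Measurable.aestronglyMeasurable (by fun_prop)) ?_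
    · exact ((measure_mono inter_subset_right).trans_lt measure_ball_lt_top).ne
    · refine (ae_restrict_iff' hAm).2 (Eventually.of_forall fun x hx => ?_)
      have hx1 : 1 ≤ ‖x‖ := ha1.trans hx.1
      rw [Real.norm_of_nonneg (by positivity)]
      exact mul_le_of_le_one_right (by positivity)
        ((div_le_one (by positivity)).2 (one_le_pow₀ hx1))
  have hangA : IntegrableOn (fun x : ℂ => n * angularGrad χ x) (S ∩ ball 0 R) :=
    (hmainA.sub hinvA).congr (Eventually.of_forall fun x => by simp [hmain])
  have hmainI : ∫ x in S ∩ ball 0 R, main x = Real.pi * n ^ 2 * Real.log (R / a) := by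
    rw [hmain, integral_add hinvA hangA, integral_const_mul, integral_const_mul,
      integral_norm_sq_inv_annulus ha0 hR, integral_angularGrad_annulus hdχ]
    ring
  have hgI : ∫ x in S ∩ ball 0 R, g x
      = (∫ x in S ∩ ball 0 R, gradSq ψ x) - ∫ x in S ∩ ball 0 R, main x :=
    integral_sub hψA hmainA
  rw [hsplit, hgI, hmainI, Real.log_div (ha0.trans_le hR).ne' ha0.ne']
  ring

/-- For a `C²` entire solution with degree pair `[n₊,n₋]` at infinity, the renormalized
energy `E(Ψ;B_R) − (π/2)(n₊²+n₋²) log R` has a finite limit as `R → ∞`. -/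
theorem statement8 (β : ℝ) (hβ : 0 < β) (np nm : ℤ) (ψp ψm : ℂ → ℂ)
    (hsol : EntireSolution β ψp ψm) (hdeg : HasDegreeAtInfty np nm ψp ψm) :
    ∃ L : ℝ, Tendsto
      (fun R : ℝ => Eloc β ψp ψm (ball 0 R)
        - (Real.pi / 2) * ((np : ℝ) ^ 2 + (nm : ℝ) ^ 2) * Real.log R)
      atTop (nhds L) := by
  obtain ⟨hψp, hψm, -, -, hpot⟩ := hsol
  obtain ⟨R₀, -, c, hc, -, -, ρp, ρm, χp, χm, hρp, hρm, hχp, hχm, -, hpolar, hρc, -, hint, -⟩ :=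
    hdeg
  have hmeas : ∀ f : ℂ → ℝ, Measurable fun x => ‖fderiv ℝ f x‖ ^ 2 := fun f =>
    (measurable_fderiv ℝ f).norm.pow_const 2
  obtain ⟨Lp, hLp⟩ := exists_tendsto_dirichlet_sub_log hψp hc hρp hχp
    (fun x hx => (hpolar x hx).1) (fun x hx => (hρc x hx).1)
    (hint.mono' ((hmeas ρp).add (hmeas χp)).aestronglyMeasurable
      (Eventually.of_forall fun x => by
        rw [Real.norm_of_nonneg (by positivity)]
        nlinarith [sq_nonneg ‖fderiv ℝ ρm x‖, sq_nonneg ‖fderiv ℝ χm x‖]))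
  obtain ⟨Lm, hLm⟩ := exists_tendsto_dirichlet_sub_log hψm hc hρm hχm
    (fun x hx => (hpolar x hx).2) (fun x hx => (hρc x hx).2)
    (hint.mono' ((hmeas ρm).add (hmeas χm)).aestronglyMeasurable
      (Eventually.of_forall fun x => by
        rw [Real.norm_of_nonneg (by positivity)]
        nlinarith [sq_nonneg ‖fderiv ℝ ρp x‖, sq_nonneg ‖fderiv ℝ χp x‖]))
  have hLpot := (aecover_ball (μ := (volume : Measure ℂ)) (x := (0 : ℂ))
    tendsto_id).integral_tendsto_of_countably_generated hpot
  refine ⟨_, (((hLp.add hLm).const_mul (1 / 2)).add (hLpot.const_mul (1 / 4))).congr fun R => ?_⟩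
  have hballint : ∀ ψ : ℂ → ℂ, ContDiff ℝ 2 ψ → IntegrableOn (gradSq ψ) (ball 0 R) := by
    intro ψ hψ
    have hcont : Continuous (gradSq ψ) := by
      have h := hψ.continuous_fderiv two_ne_zero
      unfold gradSq
      fun_prop
    exact (hcont.continuousOn.integrableOn_compact (isCompact_closedBall 0 R)).mono_set
      ball_subset_closedBall
  have hE : Eloc β ψp ψm (ball 0 R) =
      1 / 2 * ((∫ x in ball 0 R, gradSq ψp x) + ∫ x in ball 0 R, gradSq ψm x)
      + 1 / 4 * ∫ x in ball 0 R,
        ((‖ψp x‖ ^ 2 + ‖ψm x‖ ^ 2 - 1) ^ 2 + β * (‖ψp x‖ ^ 2 - ‖ψm x‖ ^ 2) ^ 2) := by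
    have hgrad : IntegrableOn (fun x => gradSq ψp x + gradSq ψm x) (ball 0 R) :=
      (hballint ψp hψp).add (hballint ψm hψm)
    rw [← integral_add (hballint ψp hψp) (hballint ψm hψm), ← integral_const_mul,
      ← integral_const_mul, ← integral_add (hgrad.const_mul (1 / 2))
        (hpot.integrableOn.const_mul (1 / 4))]
    unfold Eloc eDen1
    congr 1
    funext x
    ring
  rw [hE]
  simp only [id]
  ring
end
end
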